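/- For every i with 1 ≤ i ≤ n−2, k_i ≤ k_{i+1}; that is, the crossing indices k_i are monotonically non-decreasing in i. -/

import Mathlib

/-- Path distance along `P` between vertices `a` and `b`. -/
noncomputable def dP {X : Type*} [MetricSpace X] (v : ℕ → X) (a b : ℕ) : ℝ :=
  ∑ m ∈ Finset.Ico (min a b) (max a b), dist (v m) (v (m + 1))

/-- Shortest-path distance in the augmented graph `G(i,j)`. -/
noncomputable def dG {X : Type*} [MetricSpace X] (v : ℕ → X) (i j a b : ℕ) : ℝ :=
  min (dP v a b)
    (min (dP v a i + dist (v i) (v j) + dP v j b)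
         (dP v a j + dist (v i) (v j) + dP v i b))

/-- Eccentricity of vertex `c` in `G(i,j)`: `max_{1 ≤ k ≤ n} dG(c,k)`. -/
noncomputable def ecc {X : Type*} [MetricSpace X] (v : ℕ → X) (n i j c : ℕ) : ℝ :=
  sSup ((fun k => dG v i j c k) '' Set.Icc 1 n)

/-- Radius of `G(i,j)`: `min_{1 ≤ c ≤ n} ecc(i,j,c)`. -/
noncomputable def rad {X : Type*} [MetricSpace X] (v : ℕ → X) (n i j : ℕ) : ℝ :=
  sInf ((fun c => ecc v n i j c) '' Set.Icc 1 n)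

/-- Optimal radius: `min_{1 ≤ i ≤ j ≤ n} rad(i,j)`. -/
noncomputable def rstar {X : Type*} [MetricSpace X] (v : ℕ → X) (n : ℕ) : ℝ :=
  sInf {x | ∃ i j : ℕ, 1 ≤ i ∧ i ≤ j ∧ j ≤ n ∧ x = rad v n i j}

/-- `λ_i = min_{i ≤ j ≤ n} max_{i ≤ k ≤ n} dG(i,j)(i,k)`. -/
noncomputable def lam {X : Type*} [MetricSpace X] (v : ℕ → X) (n i : ℕ) : ℝ :=
  sInf ((fun j => sSup ((fun k => dG v i j i k) '' Set.Icc i n)) '' Set.Icc i n)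

/-- `r_i = min_{1 ≤ c ≤ i} max( dP(1,c), dP(c,i) + λ_i )`. -/
noncomputable def rI {X : Type*} [MetricSpace X] (v : ℕ → X) (n i : ℕ) : ℝ :=
  sInf ((fun c => max (dP v 1 c) (dP v c i + lam v n i)) '' Set.Icc 1 i)

/-- `k_i`: the largest `k ∈ {1,…,i}` with `dP(1,k) ≤ dP(k,i) + λ_i`. -/
noncomputable def kI {X : Type*} [MetricSpace X] (v : ℕ → X) (n i : ℕ) : ℕ :=
  sSup {k : ℕ | 1 ≤ k ∧ k ≤ i ∧ dP v 1 k ≤ dP v k i + lam v n i}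

theorem aux_dP_nonneg {X : Type*} [MetricSpace X] (v : ℕ → X) (a b : ℕ) : 0 ≤ dP v a b :=
  Finset.sum_nonneg fun _ _ => dist_nonneg

theorem aux_dP_self {X : Type*} [MetricSpace X] (v : ℕ → X) (a : ℕ) : dP v a a = 0 := by
  simp [dP]

theorem aux_dP_right {X : Type*} [MetricSpace X] (v : ℕ → X) (a b : ℕ) (h : a ≤ b) :
    dP v a (b + 1) = dP v a b + dist (v b) (v (b + 1)) := by
  unfold dP
  rw [min_eq_left h, max_eq_right h, min_eq_left (by omega), max_eq_right (by omega),
    Finset.sum_Ico_succ_top h]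

theorem aux_dP_left {X : Type*} [MetricSpace X] (v : ℕ → X) (a b : ℕ) (h : a + 1 ≤ b) :
    dP v a b = dist (v a) (v (a + 1)) + dP v (a + 1) b := by
  unfold dP
  rw [min_eq_left h, max_eq_right h, min_eq_left (by omega), max_eq_right (by omega),
    Finset.sum_eq_sum_Ico_succ_bot (by omega)]

theorem aux_dG_nonneg {X : Type*} [MetricSpace X] (v : ℕ → X) (i j a b : ℕ) :
    0 ≤ dG v i j a b := by
  have := aux_dP_nonneg v
  unfold dG
  refine le_min (this _ _) (le_min ?_ ?_) <;>
  exact add_nonneg (add_nonneg (this _ _) dist_nonneg) (this _ _)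

theorem aux_bdd {X : Type*} [MetricSpace X] (v : ℕ → X) (n i j : ℕ) :
    BddAbove ((fun k => dG v i j i k) '' Set.Icc i n) :=
  ((Set.finite_Icc i n).image _).bddAbove

theorem aux_sup_nonneg {X : Type*} [MetricSpace X] (v : ℕ → X) (n i j : ℕ) :
    0 ≤ sSup ((fun k => dG v i j i k) '' Set.Icc i n) := by
  apply Real.sSup_nonneg
  rintro _ ⟨k, _, rfl⟩
  exact aux_dG_nonneg v _ _ _ _

theorem aux_dG_step {X : Type*} [MetricSpace X] (v : ℕ → X) (i j k : ℕ) (h : i + 1 ≤ k) :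
    dG v i j i k ≤ dist (v i) (v (i + 1)) + dG v (i + 1) j (i + 1) k := by
  have h1 : dG v i j i k ≤ dP v i k := min_le_left _ _
  have h2 : dG v i j i k ≤ dP v i i + dist (v i) (v j) + dP v j k :=
    (min_le_right _ _).trans (min_le_left _ _)
  rw [aux_dP_left v i k h] at h1
  rw [aux_dP_self] at h2
  have h3 := dist_triangle (v i) (v (i + 1)) (v j)
  have h4 : dG v i j i k - dist (v i) (v (i + 1)) ≤ dG v (i + 1) j (i + 1) k := by
    conv_rhs => unfold dG
    refine le_min ?_ (le_min ?_ ?_)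
    · linarith
    · rw [aux_dP_self]; linarith
    · have := aux_dP_nonneg v (i + 1) j
      have : 0 ≤ dist (v (i + 1)) (v j) := dist_nonneg
      linarith
  linarith

theorem aux_lam_step {X : Type*} [MetricSpace X] (v : ℕ → X) (n i : ℕ) (h : i + 1 ≤ n) :
    lam v n i ≤ dist (v i) (v (i + 1)) + lam v n (i + 1) := by
  have key : lam v n i - dist (v i) (v (i + 1)) ≤ lam v n (i + 1) := by
    conv_rhs => unfold lam
    refine le_csInf ⟨_, Set.mem_image_of_mem _ (Set.mem_Icc.2 ⟨le_refl (i + 1), h⟩)⟩ ?_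
    rintro _ ⟨j, hj, rfl⟩
    have hj' := Set.mem_Icc.1 hj
    have h1 : lam v n i ≤ sSup ((fun k => dG v i j i k) '' Set.Icc i n) := by
      unfold lam
      refine csInf_le ((Set.finite_Icc i n).image _).bddBelow ?_
      exact Set.mem_image_of_mem (fun j => sSup ((fun k => dG v i j i k) '' Set.Icc i n))
        (Set.mem_Icc.2 ⟨by omega, hj'.2⟩)
    have h2 : sSup ((fun k => dG v i j i k) '' Set.Icc i n) ≤ dist (v i) (v (i + 1)) +
        sSup ((fun k => dG v (i + 1) j (i + 1) k) '' Set.Icc (i + 1) n) := by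
      have hs := aux_sup_nonneg v n (i + 1) j
      have hd : 0 ≤ dist (v i) (v (i + 1)) := dist_nonneg
      refine csSup_le ⟨_, Set.mem_image_of_mem _ (Set.mem_Icc.2 ⟨le_refl i, by omega⟩)⟩ ?_
      rintro _ ⟨k, hk, rfl⟩
      have hk' := Set.mem_Icc.1 hk
      rcases Nat.lt_or_ge i k with hik | hik
      · have a1 := aux_dG_step v i j k hik
        have a2 : dG v (i + 1) j (i + 1) k ≤ _ := le_csSup (aux_bdd v n (i + 1) j)
          (Set.mem_image_of_mem (fun k => dG v (i + 1) j (i + 1) k)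
            (Set.mem_Icc.2 ⟨hik, hk'.2⟩))
        show dG v i j i k ≤ _
        linarith
      · have : k = i := by omega
        subst this
        have a1 : dG v k j k k ≤ dP v k k := min_le_left _ _
        rw [aux_dP_self] at a1
        show dG v k j k k ≤ _
        linarith
    show _ ≤ sSup ((fun k => dG v (i + 1) j (i + 1) k) '' Set.Icc (i + 1) n)
    linarith
  linarith

/-- the crossing indices `k_i` are monotonically non-decreasing. -/
theorem stmt_8 {X : Type*} [MetricSpace X] (n : ℕ) (hn : 2 ≤ n) (v : ℕ → X)
    (hv : Set.InjOn v (Set.Icc 1 n))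
    (i : ℕ) (hi : 1 ≤ i) (hin : i ≤ n - 2) :
    kI v n i ≤ kI v n (i + 1) := by
  unfold kI
  rcases Set.eq_empty_or_nonempty {k : ℕ | 1 ≤ k ∧ k ≤ i ∧ dP v 1 k ≤ dP v k i + lam v n i}
    with h | h
  · rw [h]; simp
  · refine csSup_le_csSup ⟨i + 1, fun k hk => hk.2.1⟩ h ?_
    rintro k ⟨h1, h2, h3⟩
    refine ⟨h1, by omega, ?_⟩
    rw [aux_dP_right v k i h2]
    have := aux_lam_step v n i (by omega)
    linarith
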